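/- arXiv:2602.24264 — 10 statements merged into one kernel-verified Lean document; each statement's English description precedes it below -/
import Mathlib

section
/- Let k ≥ 1, n ≥ 2, and d ≥ 0 be natural numbers. Suppose there exist vectors z_c ∈ ℝ^d for every tuple c ∈ ({1,…,n})^k, together with probe vectors w_{i,j} ∈ ℝ^d and biases b_{i,j} ∈ ℝ for each i ∈ {1,…,k} and j ∈ {1,…,n}, such that for every tuple c and every concept index i, the value c_i is the unique maximizer over j ∈ {1,…,n} of the affine score ⟪w_{i,j}, z_c⟫ + b_{i,j}. Then d ≥ k. -/
open scoped RealInnerProductSpace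

/-- If the affine functionals `x ↦ ⟪v i, x⟫ + β i` realize every sign pattern, then their linear
parts are linearly independent. -/
theorem linearIndependent_of_forall_sign_pattern {ι E : Type*} [Fintype ι]
    [NormedAddCommGroup E] [InnerProductSpace ℝ E] (v : ι → E) (β : ι → ℝ)
    (hs : ∀ s : Set ι, ∃ x : E, ∀ i,
      (i ∈ s → 0 < ⟪v i, x⟫ + β i) ∧ (i ∉ s → ⟪v i, x⟫ + β i < 0)) :
    LinearIndependent ℝ v := by
  -- A nontrivial relation `∑ g i • v i = 0` would force `∑ g i * β i` to be positive; apply this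
  -- to both `g` and `-g`.
  have pos : ∀ g : ι → ℝ, ∑ i, g i • v i = 0 → ∀ i, g i ≠ 0 → 0 < ∑ i, g i * β i := by
    intro g hg i₀ hi₀
    obtain ⟨x, hx⟩ := hs {i | 0 < g i}
    have term_pos : ∀ i, g i ≠ 0 → 0 < g i * (⟪v i, x⟫ + β i) := by
      intro i hi
      rcases lt_or_gt_of_ne hi with hneg | hpos
      · exact mul_pos_of_neg_of_neg hneg ((hx i).2 hneg.not_gt)
      · exact mul_pos hpos ((hx i).1 hpos)
    have sum_pos : 0 < ∑ i, g i * (⟪v i, x⟫ + β i) := by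
      refine Finset.sum_pos' (fun i _ => ?_) ⟨i₀, Finset.mem_univ _, term_pos i₀ hi₀⟩
      by_cases hi : g i = 0
      · simp [hi]
      · exact (term_pos i hi).le
    have inner_sum : ∑ i, g i * ⟪v i, x⟫ = 0 := by
      simpa [sum_inner, real_inner_smul_left] using congrArg (fun y => ⟪y, x⟫) hg
    simpa [mul_add, Finset.sum_add_distrib, inner_sum] using sum_pos
  rw [Fintype.linearIndependent_iff]
  intro g hg i
  by_contra hi
  have hpos := pos g hg i hi
  have hneg := pos (-g) (by simp [hg]) i (by simpa using hi)
  simp only [Pi.neg_apply, neg_mul, Finset.sum_neg_distrib] at hneg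
  linarith

/-- **Minimum dimension for linear probes.**
If linear probes `(w i j, b i j)` correctly classify the full concept grid
`(Fin k → Fin n)` from embeddings `z c ∈ ℝ^d`, in the sense that for every
tuple `c` and concept `i` the score at `j = c i` is the unique maximizer over
`j`, then `d ≥ k`. -/
theorem stmt_2 (k n d : ℕ) (hk : 1 ≤ k) (hn : 2 ≤ n)
    (z : (Fin k → Fin n) → EuclideanSpace ℝ (Fin d))
    (w : Fin k → Fin n → EuclideanSpace ℝ (Fin d))
    (b : Fin k → Fin n → ℝ)
    (h : ∀ (c : Fin k → Fin n) (i : Fin k) (j : Fin n), j ≠ c i →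
      ⟪w i j, z c⟫ + b i j < ⟪w i (c i), z c⟫ + b i (c i)) :
    k ≤ d := by
  classical
  let j₀ : Fin n := ⟨0, by omega⟩
  let j₁ : Fin n := ⟨1, by omega⟩
  have hne : j₀ ≠ j₁ := by simp [j₀, j₁]
  have hv : LinearIndependent ℝ fun i => w i j₁ - w i j₀ := by
    refine linearIndependent_of_forall_sign_pattern _ (fun i => b i j₁ - b i j₀) fun s => ?_
    refine ⟨z fun i => if i ∈ s then j₁ else j₀, fun i => ⟨fun hi => ?_, fun hi => ?_⟩⟩
    · have := h (fun i => if i ∈ s then j₁ else j₀) i j₀ (by simpa [hi] using hne)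
      simp only [hi, if_true] at this
      rw [inner_sub_left]
      linarith
    · have := h (fun i => if i ∈ s then j₁ else j₀) i j₁ (by simpa [hi] using hne.symm)
      simp only [hi, if_false] at this
      rw [inner_sub_left]
      linarith
  simpa using hv.fintype_card_le_finrank
end

section
/- Let k ≥ 1 and n ≥ 1. Define, for each tuple c ∈ ({0,…,n−1})^k, the embedding z_c = Σ_{i=1}^{k} c_i · e_i ∈ ℝ^k, where e_1,…,e_k is the standard basis of ℝ^k and c_i is interpreted as a real number. Define probes w_{i,j} = 2j · e_i and biases b_{i,j} = −j² for i ∈ {1,…,k}, j ∈ {0,…,n−1}. Then for every tuple c and every i, the value c_i is the unique maximizer over j ∈ {0,…,n−1} of ⟪w_{i,j}, z_c⟫ + b_{i,j}; that is, all n^k combinations are correctly classified by linear probes in dimension d = k. -/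
open scoped RealInnerProductSpace

/-- Pairing `a • e i` with `∑ i', x i' • e i'` reads off `a * x i`. -/
theorem inner_smul_single_sum_smul_single {ι : Type*} [Fintype ι] [DecidableEq ι]
    (a : ℝ) (x : ι → ℝ) (i : ι) :
    ⟪a • EuclideanSpace.single i (1 : ℝ),
      ∑ i' : ι, x i' • EuclideanSpace.single i' (1 : ℝ)⟫ = a * x i := by
  simp [inner_smul_left, inner_sum, inner_smul_right, EuclideanSpace.inner_single_left,
    mul_comm]

/-- **Tightness construction for the minimum-dimension bound.**
With embeddings `z c = ∑ i, c i • e i ∈ ℝ^k`, probes `w i j = 2j • e i` and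
biases `b i j = −j²`, every concept value `c i` is the unique maximizer of the
affine score over `j ∈ {0,…,n−1}`: all `n^k` combinations are correctly
classified by linear probes in dimension `d = k`. -/
theorem stmt_3 (k n : ℕ) (hk : 1 ≤ k) (hn : 1 ≤ n)
    (c : Fin k → Fin n) (i : Fin k) (j : Fin n) (hj : j ≠ c i) :
    ⟪(2 * ((j : ℕ) : ℝ)) • EuclideanSpace.single i (1 : ℝ),
        ∑ i' : Fin k, (((c i' : ℕ) : ℝ)) • EuclideanSpace.single i' (1 : ℝ)⟫ +
        (-((j : ℕ) : ℝ) ^ 2)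
      < ⟪(2 * ((c i : ℕ) : ℝ)) • EuclideanSpace.single i (1 : ℝ),
          ∑ i' : Fin k, (((c i' : ℕ) : ℝ)) • EuclideanSpace.single i' (1 : ℝ)⟫ +
        (-((c i : ℕ) : ℝ) ^ 2) := by
  have hne : ((j : ℕ) : ℝ) - ((c i : ℕ) : ℝ) ≠ 0 :=
    sub_ne_zero.mpr fun h => hj (Fin.ext (Nat.cast_injective h))
  rw [inner_smul_single_sum_smul_single _ fun i' => ((c i' : ℕ) : ℝ),
    inner_smul_single_sum_smul_single _ fun i' => ((c i' : ℕ) : ℝ)]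
  linarith [sq_pos_of_ne_zero hne,
    sub_sq ((j : ℕ) : ℝ) ((c i : ℕ) : ℝ)]
end

section
/- Let k ≥ 2 and n ≥ 2. Suppose there exist probe vectors w_{i,j} ∈ ℝ^d for each i ∈ {1,…,k}, j ∈ {1,…,n}, and representations z_c ∈ ℝ^d for each tuple c ∈ ({1,…,n})^k, and real constants α ≠ β with α ≠ −(n−1)β, such that the on-off pattern holds: ⟪w_{i,j}, z_c⟫ = α whenever j = c_i, and ⟪w_{i,j}, z_c⟫ = β whenever j ≠ c_i, for all i, j, c. Then d ≥ 1 + k(n−1). -/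
open scoped RealInnerProductSpace

/-- A vector `x` together with a family `v` is linearly independent as soon as some vector detects
`x` and annihilates `v`, and some family is dual to `v` up to a nonzero scalar. -/
theorem linearIndependent_option_of_inner {E ι : Type*} [NormedAddCommGroup E]
    [InnerProductSpace ℝ E] [Fintype ι] [DecidableEq ι] {x u : E} {v w : ι → E} {γ : ℝ}
    (hγ : γ ≠ 0) (hx : ⟪u, x⟫ ≠ 0) (hv : ∀ q, ⟪u, v q⟫ = 0)
    (hw : ∀ p q, ⟪w p, v q⟫ = if p = q then γ else 0) :
    LinearIndependent ℝ (fun o : Option ι => o.elim x v) := by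
  rw [Fintype.linearIndependent_iff]
  intro g hg
  rw [Fintype.sum_option] at hg
  have key (y : E) : g none * ⟪y, x⟫ + ∑ q, g (some q) * ⟪y, v q⟫ = 0 := by
    simpa [inner_add_right, inner_sum, inner_smul_right] using congrArg (fun t => ⟪y, t⟫) hg
  have hnone : g none = 0 := by simpa [hv, hx] using key u
  rintro (_ | p)
  · exact hnone
  · simpa [hnone, hw, hγ] using key (w p)

/-- **Minimal dimensionality from fixed dot-products.**
If probes and representations realize the on-off pattern — score `α` on a
match (`j = c i`) and `β` on a mismatch — with `α ≠ β` and `α ≠ −(n−1)β`,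
then the embedding dimension satisfies `d ≥ 1 + k(n−1)`. -/
theorem stmt_4 (k n d : ℕ) (hk : 2 ≤ k) (hn : 2 ≤ n) (α β : ℝ)
    (hαβ : α ≠ β) (hα : α ≠ -((n : ℝ) - 1) * β)
    (w : Fin k → Fin n → EuclideanSpace ℝ (Fin d))
    (z : (Fin k → Fin n) → EuclideanSpace ℝ (Fin d))
    (h : ∀ (i : Fin k) (j : Fin n) (c : Fin k → Fin n),
      ⟪w i j, z c⟫ = if j = c i then α else β) :
    1 + k * (n - 1) ≤ d := by
  obtain ⟨m, rfl⟩ : ∃ m, n = m + 1 := ⟨n - 1, by omega⟩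
  let c₀ : Fin k → Fin (m + 1) := fun _ => 0
  let i₀ : Fin k := ⟨0, by omega⟩
  have hsum (c : Fin k → Fin (m + 1)) : ⟪∑ j, w i₀ j, z c⟫ = α + m * β := by
    rw [sum_inner, Finset.sum_congr rfl fun j _ => h i₀ j c,
      ← Finset.add_sum_erase _ _ (Finset.mem_univ (c i₀)), if_pos rfl,
      Finset.sum_congr rfl fun j hj => if_neg (Finset.ne_of_mem_erase hj)]
    simp
  have hli := linearIndependent_option_of_inner (x := z c₀) (u := ∑ j, w i₀ j)
    (v := fun p : Fin k × Fin m => z (Function.update c₀ p.1 p.2.succ) - z c₀)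
    (w := fun p => w p.1 p.2.succ) (sub_ne_zero.mpr hαβ)
    (by
      rw [hsum]
      intro h0
      apply hα
      push_cast
      linarith)
    (fun q => by rw [inner_sub_right, hsum, hsum, sub_self])
    (by
      rintro ⟨i, j⟩ ⟨i', j'⟩
      rw [inner_sub_right, h, h, if_neg (Fin.succ_ne_zero j)]
      by_cases hi : i = i'
      · subst hi
        by_cases hj : j = j' <;> simp [hj]
      · simp [hi, c₀])
  simpa [add_comm] using hli.fintype_card_le_finrank
end

section
/- Let k ≥ 2, n ≥ 2, and let α, β ∈ ℝ with α ≠ β and α + (n−1)β ≠ 0. Define the matrix Y with rows indexed by pairs (i,j), i ∈ {1,…,k}, j ∈ {1,…,n}, and columns indexed by tuples c ∈ ({1,…,n})^k, with entries Y_{(i,j),c} = α if j = c_i and Y_{(i,j),c} = β if j ≠ c_i. Then the rank of Y equals 1 + k(n−1). -/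
/-- The coordinate indicator `c ↦ 1[j = c i]` on tuples. -/
def coordIndicator (K : Type*) [Field K] {k n : ℕ} (i : Fin k) (j : Fin n) :
    (Fin k → Fin n) → K :=
  fun c => if j = c i then 1 else 0

/-- The constant function `1`, together with the indicators of the nonzero values of every
coordinate. -/
def reducedIndicators (K : Type*) [Field K] (k m : ℕ) :
    Option (Fin k × Fin m) → (Fin k → Fin (m + 1)) → K
  | none => 1
  | some p => coordIndicator K p.1 p.2.succ

lemma sum_coordIndicator (K : Type*) [Field K] {k n : ℕ} (i : Fin k) :
    ∑ j : Fin n, coordIndicator K i j = 1 := by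
  ext c
  simp [coordIndicator]

lemma linearIndependent_reducedIndicators (K : Type*) [Field K] (k m : ℕ) :
    LinearIndependent K (reducedIndicators K k m) := by
  rw [Fintype.linearIndependent_iff]
  intro g hg
  have eval (c : Fin k → Fin (m + 1)) :
      g none + ∑ p : Fin k × Fin m, (if p.2.succ = c p.1 then g (some p) else 0) = 0 := by
    simpa [Fintype.sum_option, reducedIndicators, coordIndicator] using congrFun hg c
  have hnone : g none = 0 := by
    simpa [Fin.succ_ne_zero] using eval 0
  rintro (_ | ⟨i, j⟩)
  · exact hnone
  · have h := eval (Function.update 0 i j.succ)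
    rw [hnone, zero_add, Finset.sum_eq_single (i, j)] at h
    · simpa using h
    · rintro ⟨i', j'⟩ - hne
      refine if_neg fun heq => hne ?_
      by_cases hi : i' = i
      · subst hi
        simpa using heq
      · simp [Function.update_of_ne hi, Fin.succ_ne_zero] at heq
    · simp

lemma coordIndicator_mem_span_reducedIndicators (K : Type*) [Field K] {k m : ℕ}
    (i : Fin k) (j : Fin (m + 1)) :
    coordIndicator K i j ∈ Submodule.span K (Set.range (reducedIndicators K k m)) := by
  have hsucc (j : Fin m) : coordIndicator K i j.succ ∈
      Submodule.span K (Set.range (reducedIndicators K k m)) :=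
    Submodule.subset_span ⟨some (i, j), rfl⟩
  refine Fin.cases ?_ hsucc j
  have h := sum_coordIndicator K (n := m + 1) i
  rw [Fin.sum_univ_succ, ← eq_sub_iff_add_eq] at h
  rw [h]
  exact Submodule.sub_mem _ (Submodule.subset_span ⟨none, rfl⟩)
    (Submodule.sum_mem _ fun j _ => hsucc j)

lemma onOff_row_eq {K : Type*} [Field K] {k n : ℕ} (α β : K) (i : Fin k) (j : Fin n) :
    (fun c : Fin k → Fin n => if j = c i then α else β) =
      β • (1 : (Fin k → Fin n) → K) + (α - β) • coordIndicator K i j := by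
  ext c
  by_cases h : j = c i <;> simp [coordIndicator, h]

lemma span_onOff_rows_eq {K : Type*} [Field K] {k m : ℕ} (hk : 0 < k) {α β : K}
    (hαβ : α ≠ β) (hsum : α + m * β ≠ 0) :
    Submodule.span K (Set.range fun (p : Fin k × Fin (m + 1)) (c : Fin k → Fin (m + 1)) =>
      if p.2 = c p.1 then α else β) =
      Submodule.span K (Set.range (reducedIndicators K k m)) := by
  apply le_antisymm <;> rw [Submodule.span_le]
  · rintro _ ⟨⟨i, j⟩, rfl⟩
    simp only [onOff_row_eq]
    exact Submodule.add_mem _ (Submodule.smul_mem _ _ (Submodule.subset_span ⟨none, rfl⟩))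
      (Submodule.smul_mem _ _ (coordIndicator_mem_span_reducedIndicators K i j))
  · set S := Submodule.span K (Set.range
      fun (p : Fin k × Fin (m + 1)) (c : Fin k → Fin (m + 1)) => if p.2 = c p.1 then α else β)
    have hrow (i : Fin k) (j : Fin (m + 1)) :
        β • (1 : (Fin k → Fin (m + 1)) → K) + (α - β) • coordIndicator K i j ∈ S := by
      rw [← onOff_row_eq]
      exact Submodule.subset_span ⟨(i, j), rfl⟩
    have hone : (1 : (Fin k → Fin (m + 1)) → K) ∈ S := by
      rw [← Submodule.smul_mem_iff S hsum]
      convert Submodule.sum_mem S fun j (_ : j ∈ Finset.univ) => hrow ⟨0, hk⟩ j using 1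
      rw [Finset.sum_add_distrib, ← Finset.smul_sum, ← Finset.smul_sum, sum_coordIndicator]
      ext c
      simp
      ring
    rintro _ ⟨_ | ⟨i, j⟩, rfl⟩
    · exact hone
    · rw [SetLike.mem_coe, ← Submodule.smul_mem_iff S (sub_ne_zero.mpr hαβ)]
      exact (Submodule.add_mem_iff_right S (S.smul_mem β hone)).mp (hrow i j.succ)

/-- **Rank of the on-off logit matrix.**
The matrix `Y` with rows indexed by pairs `(i,j)` and columns indexed by
tuples `c ∈ (Fin k → Fin n)`, whose entry is `α` when `j = c i` and `β`
otherwise, has rank exactly `1 + k(n−1)` provided `α ≠ β` and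
`α + (n−1)β ≠ 0`. -/
theorem stmt_5 (k n : ℕ) (hk : 2 ≤ k) (hn : 2 ≤ n) (α β : ℝ)
    (hαβ : α ≠ β) (hsum : α + ((n : ℝ) - 1) * β ≠ 0) :
    (Matrix.of fun (p : Fin k × Fin n) (c : Fin k → Fin n) =>
      if p.2 = c p.1 then α else β).rank = 1 + k * (n - 1) := by
  obtain ⟨m, rfl⟩ : ∃ m, n = m + 1 := ⟨n - 1, by omega⟩
  rw [Matrix.rank_eq_finrank_span_row]
  change Module.finrank ℝ (Submodule.span ℝ (Set.range
    fun (p : Fin k × Fin (m + 1)) (c : Fin k → Fin (m + 1)) => if p.2 = c p.1 then α else β)) = _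
  rw [span_onOff_rows_eq (by omega) hαβ (by simpa using hsum),
    finrank_span_eq_card (linearIndependent_reducedIndicators ℝ k m)]
  simp [add_comm]
end

section
/- Let k ≥ 2, n ≥ 2, and let α > β be real numbers. Suppose probe vectors w_{i,j} ∈ ℝ^d (i ∈ {1,…,k}, j ∈ {1,…,n}) and representations z_c ∈ ℝ^d (c ∈ ({1,…,n})^k) satisfy the on-off pattern: ⟪w_{i,j}, z_c⟫ = α if j = c_i and = β if j ≠ c_i. Define the global mean z̄ = n^(−k) Σ_c z_c, conditional means a_{i,j} = n^(−(k−1)) Σ_{c : c_i = j} z_c, centered factors u_{i,j} = a_{i,j} − z̄, and reconstructed representations z̃_c = z̄ + Σ_{i=1}^{k} u_{i,c_i}. Then for every i, j, c: ⟪w_{i,j}, z̃_c⟫ = ⟪w_{i,j}, z_c⟫, i.e. ⟪w_{i,j}, z̃_c⟫ = α if j = c_i and = β otherwise; so the additive reconstructions are indistinguishable from the original representations to all probes. -/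
open scoped RealInnerProductSpace

/-- If `g` does not depend on the coordinate `t`, its sum over all tuples is `card κ` times its sum
over the tuples whose `t`-th entry is a fixed `v`. -/
theorem sum_eq_card_nsmul_sum_filter_of_update_eq {ι κ M : Type*} [Fintype ι] [DecidableEq ι]
    [Fintype κ] [DecidableEq κ] [AddCommMonoid M] (g : (ι → κ) → M) (t : ι)
    (hg : ∀ c x, g (Function.update c t x) = g c) (v : κ) :
    ∑ c, g c = Fintype.card κ • ∑ c ∈ Finset.univ.filter (fun c : ι → κ => c t = v), g c := by
  rw [← Finset.sum_fiberwise (s := Finset.univ) (g := fun c : ι → κ => c t), ← Finset.card_univ]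
  refine Finset.sum_eq_card_nsmul fun x _ => ?_
  refine Finset.sum_bij' (fun c _ => Function.update c t v) (fun c _ => Function.update c t x)
    ?_ ?_ ?_ ?_ ?_ <;> simp +contextual [hg]

/-- **Additive factorization from the on-off pattern.**
Assume probes and representations satisfy the on-off pattern (score `α` on a
match, `β` on a mismatch, `β < α`). Define the global mean
`z̄ = n^(−k) ∑ c, z c`, conditional means
`a t v = n^(−(k−1)) ∑_{c : c t = v} z c`, centered factors
`u t v = a t v − z̄`, and reconstructions `z̃ c = z̄ + ∑ t, u t (c t)`.
Then every probe score on `z̃ c` agrees with its score on `z c`: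
`⟪w i j, z̃ c⟫ = α` if `j = c i` and `β` otherwise. -/
theorem stmt_6 (k n d : ℕ) (hk : 2 ≤ k) (hn : 2 ≤ n) (α β : ℝ) (hαβ : β < α)
    (w : Fin k → Fin n → EuclideanSpace ℝ (Fin d))
    (z : (Fin k → Fin n) → EuclideanSpace ℝ (Fin d))
    (h : ∀ (i : Fin k) (j : Fin n) (c : Fin k → Fin n),
      ⟪w i j, z c⟫ = if j = c i then α else β) :
    ∀ (i : Fin k) (j : Fin n) (c : Fin k → Fin n),
      ⟪w i j,
        (((n : ℝ) ^ k)⁻¹ • ∑ c' : Fin k → Fin n, z c') +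
          ∑ t : Fin k,
            ((((n : ℝ) ^ (k - 1))⁻¹ •
                ∑ c' ∈ Finset.univ.filter (fun c' : Fin k → Fin n => c' t = c t), z c') -
              ((n : ℝ) ^ k)⁻¹ • ∑ c' : Fin k → Fin n, z c')⟫
      = if j = c i then α else β := by
  intro i j c
  have hn0 : (n : ℝ) ≠ 0 := by positivity
  have hpow : (n : ℝ) ^ k = n * n ^ (k - 1) := by
    rw [← pow_succ']
    congr 1
    omega
  simp only [inner_add_right, inner_sum, inner_sub_right, inner_smul_right, h]
  rw [Finset.sum_eq_single i]
  · have hmatch : ∑ c' ∈ Finset.univ.filter (fun c' : Fin k → Fin n => c' i = c i),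
        (if j = c' i then α else β) = (n : ℝ) ^ (k - 1) * if j = c i then α else β := by
      have hconst := sum_eq_card_nsmul_sum_filter_of_update_eq
        (fun _ : Fin k → Fin n => if j = c i then α else β) i (fun _ _ => rfl) (c i)
      rw [Finset.sum_const, Finset.card_univ, Fintype.card_fun, Fintype.card_fin, Fintype.card_fin,
        nsmul_eq_mul, nsmul_eq_mul, Nat.cast_pow, hpow, mul_assoc] at hconst
      rw [mul_left_cancel₀ hn0 hconst]
      refine Finset.sum_congr rfl fun c' hc' => ?_
      rw [(Finset.mem_filter.mp hc').2]
    rw [hmatch, inv_mul_cancel_left₀ (pow_ne_zero _ hn0)]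
    ring
  · intro t _ hti
    rw [sum_eq_card_nsmul_sum_filter_of_update_eq
      (fun c' : Fin k → Fin n => if j = c' i then α else β) t
      (fun c' x => by simp [Function.update_of_ne hti.symm]) (c t),
      Fintype.card_fin, nsmul_eq_mul, hpow]
    field_simp
    ring
  · simp
end

section
/- Let the concept space be C = C_1 × ⋯ × C_k where each C_i is a nonempty finite set. Suppose two families of vectors {u_{i,j} ∈ ℝ^d : i ∈ {1,…,k}, j ∈ C_i} and {v_{i,j} ∈ ℝ^d : i ∈ {1,…,k}, j ∈ C_i} satisfy Σ_{i=1}^{k} u_{i,c_i} = Σ_{i=1}^{k} v_{i,c_i} for every tuple c ∈ C. Then there exist vectors s_1,…,s_k ∈ ℝ^d with Σ_{i=1}^{k} s_i = 0 such that v_{i,j} = u_{i,j} + s_i for all i and all j ∈ C_i. Conversely, for any s_1,…,s_k with Σ_i s_i = 0, the family v_{i,j} = u_{i,j} + s_i satisfies Σ_i v_{i,c_i} = Σ_i u_{i,c_i} for every tuple c. -/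
/-- If the sums `∑ i, w i (c i)` vanish for every tuple `c`, each `w i` is constant. -/
theorem eq_of_forall_sum_apply_eq_zero {ι M : Type*} [Fintype ι] [AddCommGroup M]
    {C : ι → Type*} {w : ∀ i, C i → M} (h : ∀ c : ∀ i, C i, ∑ i, w i (c i) = 0)
    (c : ∀ i, C i) (i : ι) (j : C i) : w i j = w i (c i) := by
  classical
  have hsum : ∑ l, (w l (Function.update c i j l) - w l (c l)) = 0 := by
    rw [Finset.sum_sub_distrib, h, h, sub_zero]
  rw [Fintype.sum_eq_single i fun l hl => by simp [hl]] at hsum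
  simpa [sub_eq_zero] using hsum

/-- **Uniqueness of linear factorizations up to concept-wise shifts.**
If two factor families `u` and `v` over the concept space `∀ i, C i` generate
the same additive embeddings (`∑ i, u i (c i) = ∑ i, v i (c i)` for all `c`),
then there are shift vectors `s i` summing to zero with `v i j = u i j + s i`.
Conversely, any shifts summing to zero give another valid factorization. -/
theorem stmt_8 (k d : ℕ) (C : Fin k → Type) [∀ i, Fintype (C i)] [∀ i, Nonempty (C i)]
    (u v : ∀ i, C i → EuclideanSpace ℝ (Fin d)) :
    ((∀ c : ∀ i, C i, ∑ i, u i (c i) = ∑ i, v i (c i)) →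
      ∃ s : Fin k → EuclideanSpace ℝ (Fin d),
        (∑ i, s i = 0) ∧ ∀ (i : Fin k) (j : C i), v i j = u i j + s i) ∧
    (∀ s : Fin k → EuclideanSpace ℝ (Fin d), (∑ i, s i = 0) →
      ∀ c : ∀ i, C i, ∑ i, (u i (c i) + s i) = ∑ i, u i (c i)) := by
  refine ⟨fun h => ?_, fun s hs c => by rw [Finset.sum_add_distrib, hs, add_zero]⟩
  have hdiff : ∀ c : ∀ i, C i, ∑ i, (v i (c i) - u i (c i)) = 0 := fun c => by
    rw [Finset.sum_sub_distrib, h c, sub_self]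
  let a : ∀ i, C i := fun i => Classical.arbitrary (C i)
  refine ⟨fun i => v i (a i) - u i (a i), hdiff a, fun i j => ?_⟩
  beta_reduce
  rw [← eq_of_forall_sum_apply_eq_zero (w := fun i j => v i j - u i j) hdiff a i j,
    add_sub_cancel]
end

section
/- Let C = C_1 × ⋯ × C_k where each C_i is a nonempty finite set, and suppose {u_{i,j}} and {v_{i,j}} are two families of vectors in ℝ^d with Σ_{i=1}^{k} u_{i,c_i} = Σ_{i=1}^{k} v_{i,c_i} for every tuple c ∈ C. For each i let μ_i = |C_i|^(−1) Σ_{j ∈ C_i} u_{i,j} and ν_i = |C_i|^(−1) Σ_{j ∈ C_i} v_{i,j}, and define the centered factors u°_{i,j} = u_{i,j} − μ_i and v°_{i,j} = v_{i,j} − ν_i. Then u°_{i,j} = v°_{i,j} for all i ∈ {1,…,k} and all j ∈ C_i. -/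
/-- Two factor families with the same sums differ, within each concept, by a constant. -/
theorem exists_eq_add_of_sum_eq {ι E : Type*} [Fintype ι] [AddCommGroup E] {C : ι → Type*}
    [∀ i, Nonempty (C i)] {u v : ∀ i, C i → E}
    (h : ∀ c : ∀ i, C i, ∑ i, u i (c i) = ∑ i, v i (c i)) (i : ι) :
    ∃ w : E, ∀ j, u i j = v i j + w := by
  classical
  let c : ∀ i, C i := fun i => Classical.arbitrary (C i)
  refine ⟨∑ l ∈ Finset.univ.erase i, (v l (c l) - u l (c l)), fun j => ?_⟩
  have split (f : ∀ i, C i → E) : ∑ l, f l (Function.update c i j l) =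
      f i j + ∑ l ∈ Finset.univ.erase i, f l (c l) := by
    rw [← Finset.add_sum_erase _ _ (Finset.mem_univ i), Function.update_self]
    congr 1
    refine Finset.sum_congr rfl fun l hl => ?_
    rw [Function.update_of_ne (Finset.ne_of_mem_erase hl)]
  have hj := h (Function.update c i j)
  rw [split u, split v] at hj
  rw [Finset.sum_sub_distrib, ← add_sub_assoc, ← hj, add_sub_cancel_right]

/-- **Uniqueness of centered factors.**
If two factor families `u` and `v` over the concept space `∀ i, C i` generate
the same additive embeddings, then after centering each concept's factors by
subtracting their within-concept average, the two families coincide. -/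
theorem stmt_9 (k d : ℕ) (C : Fin k → Type) [∀ i, Fintype (C i)] [∀ i, Nonempty (C i)]
    (u v : ∀ i, C i → EuclideanSpace ℝ (Fin d))
    (h : ∀ c : ∀ i, C i, ∑ i, u i (c i) = ∑ i, v i (c i)) :
    ∀ (i : Fin k) (j : C i),
      u i j - ((Fintype.card (C i) : ℝ))⁻¹ • ∑ j' : C i, u i j' =
      v i j - ((Fintype.card (C i) : ℝ))⁻¹ • ∑ j' : C i, v i j' := by
  intro i j
  obtain ⟨w, hw⟩ := exists_eq_add_of_sum_eq h i
  have hcard : (Fintype.card (C i) : ℝ) ≠ 0 := Nat.cast_ne_zero.mpr Fintype.card_ne_zero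
  simp only [hw, Finset.sum_add_distrib, Finset.sum_const, Finset.card_univ, smul_add,
    ← Nat.cast_smul_eq_nsmul ℝ, inv_smul_smul₀ hcard, add_sub_add_right_eq_sub]
end

section
/- Let k ≥ 1 and let embeddings z_c ∈ ℝ^d for c ∈ {0,1}^k satisfy the binary linear factorization z_c = Σ_{i=1}^{k} u_{i,c_i} for some vectors u_{i,0}, u_{i,1} ∈ ℝ^d. Fix a concept index i. Then for every pair of convex combinations y₊ = Σ_{c : c_i = 1} λ_c z_c and y₋ = Σ_{c : c_i = 0} γ_c z_c (with λ_c, γ_c ≥ 0, Σ_{c : c_i=1} λ_c = 1, Σ_{c : c_i=0} γ_c = 1), there exist real coefficients Δ_j for j ≠ i such that y₊ − y₋ = (u_{i,1} − u_{i,0}) + Σ_{j ≠ i} Δ_j (u_{j,1} − u_{j,0}). -/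
/-- An affine combination of points `∑ j, u j (c j)`, indexed by vertices `c` of the hypercube,
is the base point `∑ j, u j 0` plus the averaged coordinates times the difference vectors. -/
lemma sum_smul_sum_eq_add_sum_smul_sub {ι E : Type*} [Fintype ι] [AddCommGroup E] [Module ℝ E]
    (u : ι → Fin 2 → E) (s : Finset (ι → Fin 2)) (w : (ι → Fin 2) → ℝ)
    (hw : ∑ c ∈ s, w c = 1) :
    ∑ c ∈ s, w c • ∑ j, u j (c j) =
      ∑ j, u j 0 + ∑ j, (∑ c ∈ s, w c * ((c j : ℕ) : ℝ)) • (u j 1 - u j 0) := by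
  have coord_eq (j : ι) (b : Fin 2) : u j b = u j 0 + ((b : ℕ) : ℝ) • (u j 1 - u j 0) := by
    fin_cases b <;> simp
  have vertex_eq (c : ι → Fin 2) :
      ∑ j, u j (c j) = ∑ j, u j 0 + ∑ j, ((c j : ℕ) : ℝ) • (u j 1 - u j 0) := by
    rw [← Finset.sum_add_distrib]
    exact Finset.sum_congr rfl fun j _ => coord_eq j (c j)
  rw [Finset.sum_congr rfl fun c _ => congrArg (w c • ·) (vertex_eq c)]
  simp_rw [smul_add, Finset.sum_add_distrib, ← Finset.sum_smul, hw, one_smul,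
    Finset.smul_sum, smul_smul, Finset.sum_smul]
  rw [Finset.sum_comm]

/-- **Difference of class convex combinations under binary linear factorization.**
If `z c = ∑ i, u i (c i)` on the hypercube, then for any convex combinations
`y₊` of `{z c : c i = 1}` and `y₋` of `{z c : c i = 0}`, the difference
`y₊ − y₋` equals `(u i 1 − u i 0)` plus a linear combination of the other
concepts' difference vectors. -/
theorem stmt_11 (k d : ℕ) (hk : 1 ≤ k)
    (u : Fin k → Fin 2 → EuclideanSpace ℝ (Fin d))
    (z : (Fin k → Fin 2) → EuclideanSpace ℝ (Fin d))
    (hz : ∀ c : Fin k → Fin 2, z c = ∑ i, u i (c i))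
    (i : Fin k) (lam gam : (Fin k → Fin 2) → ℝ)
    (hlam0 : ∀ c, 0 ≤ lam c) (hgam0 : ∀ c, 0 ≤ gam c)
    (hlam1 : ∑ c ∈ Finset.univ.filter (fun c : Fin k → Fin 2 => c i = 1), lam c = 1)
    (hgam1 : ∑ c ∈ Finset.univ.filter (fun c : Fin k → Fin 2 => c i = 0), gam c = 1) :
    ∃ Δ : Fin k → ℝ,
      (∑ c ∈ Finset.univ.filter (fun c : Fin k → Fin 2 => c i = 1), lam c • z c) -
        (∑ c ∈ Finset.univ.filter (fun c : Fin k → Fin 2 => c i = 0), gam c • z c) =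
      (u i 1 - u i 0) + ∑ j ∈ Finset.univ.erase i, Δ j • (u j 1 - u j 0) := by
  have hpos : ∑ c ∈ Finset.univ.filter (fun c : Fin k → Fin 2 => c i = 1),
      lam c * ((c i : ℕ) : ℝ) = 1 := by
    rw [← hlam1]
    refine Finset.sum_congr rfl fun c hc => ?_
    simp [(Finset.mem_filter.mp hc).2]
  have hneg : ∑ c ∈ Finset.univ.filter (fun c : Fin k → Fin 2 => c i = 0),
      gam c * ((c i : ℕ) : ℝ) = 0 := by
    refine Finset.sum_eq_zero fun c hc => ?_
    simp [(Finset.mem_filter.mp hc).2]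
  refine ⟨fun j =>
    ∑ c ∈ Finset.univ.filter (fun c : Fin k → Fin 2 => c i = 1), lam c * ((c j : ℕ) : ℝ) -
      ∑ c ∈ Finset.univ.filter (fun c : Fin k → Fin 2 => c i = 0), gam c * ((c j : ℕ) : ℝ), ?_⟩
  simp_rw [hz]
  rw [sum_smul_sum_eq_add_sum_smul_sub u _ lam hlam1,
    sum_smul_sum_eq_add_sum_smul_sub u _ gam hgam1, add_sub_add_left_eq_sub,
    ← Finset.sum_sub_distrib]
  simp_rw [← sub_smul]
  rw [← Finset.add_sum_erase _ _ (Finset.mem_univ i), hpos, hneg, sub_zero, one_smul]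
end

section
/- Let k ≥ 1 and let embeddings z_c ∈ ℝ^d for c ∈ {0,1}^k satisfy z_c = Σ_{i=1}^{k} u_{i,c_i} with cross-concept orthogonality: ⟪u_{i,1} − u_{i,0}, u_{j,1} − u_{j,0}⟫ = 0 for all i ≠ j. Fix a concept index i. Then (1) for every pair of convex combinations y₊ of {z_c : c_i = 1} and y₋ of {z_c : c_i = 0}, one has ‖y₊ − y₋‖ ≥ ‖u_{i,1} − u_{i,0}‖; and (2) for every tuple c ∈ {0,1}^k, the counterfactual pair satisfies ‖z_{c(i→1)} − z_{c(i→0)}‖ = ‖u_{i,1} − u_{i,0}‖, where c(i→v) denotes c with its i-th coordinate set to v. Consequently the distance between the convex hulls of the two classes equals ‖u_{i,1} − u_{i,0}‖. -/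
open scoped RealInnerProductSpace

theorem sum_update_sub_sum_update {ι α M : Type*} [Fintype ι] [DecidableEq ι] [AddCommGroup M]
    (u : ι → α → M) (c : ι → α) (i : ι) (v w : α) :
    ∑ j, u j (Function.update c i v j) - ∑ j, u j (Function.update c i w j) = u i v - u i w := by
  rw [← Finset.sum_sub_distrib, Finset.sum_eq_single i]
  · simp
  · intro j _ hj
    simp [hj]
  · simp

section LinearFactorization

variable {ι E : Type*} [NormedAddCommGroup E] [InnerProductSpace ℝ E]

theorem norm_le_norm_of_inner_eq_inner_self {w x : E} (h : ⟪w, x⟫ = ⟪w, w⟫) : ‖w‖ ≤ ‖x‖ := by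
  rcases (norm_nonneg w).eq_or_lt with hw | hw
  · exact hw ▸ norm_nonneg x
  · refine le_of_mul_le_mul_left ?_ hw
    rw [← real_inner_self_eq_norm_mul_norm, ← h]
    exact real_inner_le_norm w x

theorem inner_eq_of_mem_convexHull {w x : E} {s : Set E} {a : ℝ}
    (hs : ∀ y ∈ s, ⟪w, y⟫ = a) (hx : x ∈ convexHull ℝ s) : ⟪w, x⟫ = a :=
  convexHull_min (t := {y | innerSL ℝ w y = a}) hs
    (convex_hyperplane (innerSL ℝ w).toLinearMap.isLinear a) hx

/-- Along the difference vector of concept `i`, a factored embedding depends only on the value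
of concept `i`. -/
theorem inner_sum_eq_of_orthogonal [Fintype ι] [DecidableEq ι] {u : ι → Fin 2 → E} {i : ι}
    (horth : ∀ j, i ≠ j → ⟪u i 1 - u i 0, u j 1 - u j 0⟫ = 0) (c : ι → Fin 2) :
    ⟪u i 1 - u i 0, ∑ j, u j (c j)⟫ =
      ⟪u i 1 - u i 0, u i (c i)⟫ + ∑ j ∈ Finset.univ.erase i, ⟪u i 1 - u i 0, u j 0⟫ := by
  rw [inner_sum, ← Finset.add_sum_erase _ _ (Finset.mem_univ i)]
  congr 1
  refine Finset.sum_congr rfl fun j hj => ?_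
  have h := horth j (Finset.ne_of_mem_erase hj).symm
  rw [inner_sub_right, sub_eq_zero] at h
  generalize c j = v
  fin_cases v
  · rfl
  · exact h

end LinearFactorization

/-- **Pythagorean separation bound under linear factorization with
cross-concept orthogonality.**
If `z c = ∑ i, u i (c i)` with `⟪u i 1 − u i 0, u j 1 − u j 0⟫ = 0` for
`i ≠ j`, then for each concept `i`:
(1) every pair of convex combinations of the two classes is at distance at
least `‖u i 1 − u i 0‖`;
(2) every counterfactual pair is at distance exactly `‖u i 1 − u i 0‖`;
consequently the distance between the convex hulls of the two classes equals
`‖u i 1 − u i 0‖`. -/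
theorem stmt_12 (k d : ℕ) (hk : 1 ≤ k)
    (u : Fin k → Fin 2 → EuclideanSpace ℝ (Fin d))
    (z : (Fin k → Fin 2) → EuclideanSpace ℝ (Fin d))
    (hz : ∀ c : Fin k → Fin 2, z c = ∑ i, u i (c i))
    (horth : ∀ i j : Fin k, i ≠ j → ⟪u i 1 - u i 0, u j 1 - u j 0⟫ = 0)
    (i : Fin k) :
    (∀ lam gam : (Fin k → Fin 2) → ℝ,
      (∀ c, 0 ≤ lam c) → (∀ c, 0 ≤ gam c) →
      (∑ c ∈ Finset.univ.filter (fun c : Fin k → Fin 2 => c i = 1), lam c = 1) →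
      (∑ c ∈ Finset.univ.filter (fun c : Fin k → Fin 2 => c i = 0), gam c = 1) →
      ‖u i 1 - u i 0‖ ≤
        ‖(∑ c ∈ Finset.univ.filter (fun c : Fin k → Fin 2 => c i = 1), lam c • z c) -
          (∑ c ∈ Finset.univ.filter (fun c : Fin k → Fin 2 => c i = 0), gam c • z c)‖) ∧
    (∀ c : Fin k → Fin 2,
      ‖z (Function.update c i 1) - z (Function.update c i 0)‖ = ‖u i 1 - u i 0‖) ∧
    IsLeast {r : ℝ |
        ∃ p ∈ convexHull ℝ {x : EuclideanSpace ℝ (Fin d) |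
            ∃ c : Fin k → Fin 2, c i = 1 ∧ x = z c},
        ∃ q ∈ convexHull ℝ {x : EuclideanSpace ℝ (Fin d) |
            ∃ c : Fin k → Fin 2, c i = 0 ∧ x = z c},
        r = ‖p - q‖} ‖u i 1 - u i 0‖ := by
  have hinner : ∀ c, ⟪u i 1 - u i 0, z c⟫ = ⟪u i 1 - u i 0, u i (c i)⟫ +
      ∑ j ∈ Finset.univ.erase i, ⟪u i 1 - u i 0, u j 0⟫ := fun c => by
    rw [hz, inner_sum_eq_of_orthogonal (horth i)]
  have hsep : ∀ p ∈ convexHull ℝ {x | ∃ c : Fin k → Fin 2, c i = 1 ∧ x = z c},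
      ∀ q ∈ convexHull ℝ {x | ∃ c : Fin k → Fin 2, c i = 0 ∧ x = z c},
      ‖u i 1 - u i 0‖ ≤ ‖p - q‖ := by
    intro p hp q hq
    apply norm_le_norm_of_inner_eq_inner_self
    rw [inner_sub_right,
      inner_eq_of_mem_convexHull (by rintro _ ⟨c, hc, rfl⟩; rw [hinner, hc]) hp,
      inner_eq_of_mem_convexHull (by rintro _ ⟨c, hc, rfl⟩; rw [hinner, hc]) hq,
      add_sub_add_right_eq_sub, ← inner_sub_right]
  have hpair : ∀ c : Fin k → Fin 2,
      ‖z (Function.update c i 1) - z (Function.update c i 0)‖ = ‖u i 1 - u i 0‖ := fun c => by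
    rw [hz, hz, sum_update_sub_sum_update]
  have hcomb : ∀ (v : Fin 2) (a : (Fin k → Fin 2) → ℝ), (∀ c, 0 ≤ a c) →
      ∑ c ∈ Finset.univ.filter (fun c : Fin k → Fin 2 => c i = v), a c = 1 →
      ∑ c ∈ Finset.univ.filter (fun c : Fin k → Fin 2 => c i = v), a c • z c ∈
        convexHull ℝ {x | ∃ c : Fin k → Fin 2, c i = v ∧ x = z c} := fun v a ha hsum =>
    (convex_convexHull ℝ _).sum_mem (fun c _ => ha c) hsum fun c hc =>
      subset_convexHull ℝ _ ⟨c, (Finset.mem_filter.mp hc).2, rfl⟩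
  refine ⟨fun lam gam hlam hgam hl hg => hsep _ (hcomb 1 lam hlam hl) _ (hcomb 0 gam hgam hg),
    hpair, ?_, ?_⟩
  · exact ⟨_, subset_convexHull ℝ _ ⟨Function.update 0 i 1, by simp, rfl⟩,
      _, subset_convexHull ℝ _ ⟨Function.update 0 i 0, by simp, rfl⟩, (hpair 0).symm⟩
  · rintro _ ⟨p, hp, q, hq, rfl⟩
    exact hsep p hp q hq
end

section
/- Let k ≥ 1, n ≥ 1, and let d_1,…,d_k ∈ ℝ^d be nonzero pairwise orthogonal vectors. For each i let α_{i,1},…,α_{i,n} ∈ ℝ be pairwise distinct scalars. Define embeddings z_c = Σ_{i=1}^{k} α_{i,c_i} d_i for c ∈ ({1,…,n})^k, per-concept means ᾱ_ℓ = n^(−1) Σ_{r=1}^{n} α_{ℓ,r}, offsets m_i = Σ_{ℓ ≠ i} ᾱ_ℓ d_ℓ, prototypes d̃_{i,j} = α_{i,j} d_i + m_i, probes w̃_{i,j} = 2 d̃_{i,j}, and biases b̃_{i,j} = −‖d̃_{i,j}‖². Then for every tuple c and every concept i, the value c_i is the unique maximizer over j ∈ {1,…,n} of ⟪w̃_{i,j},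 z_c⟫ + b̃_{i,j}. -/
open scoped RealInnerProductSpace

/-- The affine score of the prototype `b • u + v`, with `v` orthogonal to `u`, at a point `z` whose
component along `u` is `a • u`: completing the square in `b`. -/
theorem prototype_score_eq {E : Type*} [NormedAddCommGroup E] [InnerProductSpace ℝ E]
    {u v z : E} {a : ℝ} (huv : ⟪u, v⟫ = 0) (huz : ⟪u, z⟫ = a * ‖u‖ ^ 2) (b : ℝ) :
    ⟪(2 : ℝ) • (b • u + v), z⟫ + (-‖b • u + v‖ ^ 2) =
      -(b - a) ^ 2 * ‖u‖ ^ 2 + (a ^ 2 * ‖u‖ ^ 2 + 2 * ⟪v, z⟫ - ‖v‖ ^ 2) := by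
  rw [norm_add_sq_real, real_inner_smul_left, inner_add_left, real_inner_smul_left,
    real_inner_smul_left, huv, huz, norm_smul, mul_pow, Real.norm_eq_abs, sq_abs]
  ring

/-- **Ideal LRH concept classifier.**
Let `d i` be nonzero pairwise orthogonal directions and `α i` have pairwise
distinct values within each concept. With embeddings
`z c = ∑ i, α i (c i) • d i`, per-concept means `ᾱ ℓ = n⁻¹ ∑ r, α ℓ r`,
offsets `m i = ∑_{ℓ ≠ i} ᾱ ℓ • d ℓ`, prototypes
`d̃ i j = α i j • d i + m i`, probes `w̃ i j = 2 d̃ i j` and biases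
`b̃ i j = −‖d̃ i j‖²`, the value `c i` is the unique maximizer over `j` of
the affine score, for every tuple `c` and concept `i`. -/
theorem stmt_15 (k n m : ℕ) (hk : 1 ≤ k) (hn : 1 ≤ n)
    (dv : Fin k → EuclideanSpace ℝ (Fin m))
    (hd0 : ∀ i, dv i ≠ 0)
    (horth : ∀ i j : Fin k, i ≠ j → ⟪dv i, dv j⟫ = 0)
    (α : Fin k → Fin n → ℝ)
    (hα : ∀ i : Fin k, Function.Injective (α i)) :
    ∀ (c : Fin k → Fin n) (i : Fin k) (j : Fin n), j ≠ c i →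
      ⟪(2 : ℝ) • (α i j • dv i +
            ∑ ℓ ∈ Finset.univ.erase i, ((n : ℝ)⁻¹ * ∑ r : Fin n, α ℓ r) • dv ℓ),
          ∑ t : Fin k, α t (c t) • dv t⟫ +
        (-‖α i j • dv i +
            ∑ ℓ ∈ Finset.univ.erase i, ((n : ℝ)⁻¹ * ∑ r : Fin n, α ℓ r) • dv ℓ‖ ^ 2)
      < ⟪(2 : ℝ) • (α i (c i) • dv i +
            ∑ ℓ ∈ Finset.univ.erase i, ((n : ℝ)⁻¹ * ∑ r : Fin n, α ℓ r) • dv ℓ),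
          ∑ t : Fin k, α t (c t) • dv t⟫ +
        (-‖α i (c i) • dv i +
            ∑ ℓ ∈ Finset.univ.erase i, ((n : ℝ)⁻¹ * ∑ r : Fin n, α ℓ r) • dv ℓ‖ ^ 2) := by
  intro c i j hj
  have huv : ⟪dv i, ∑ ℓ ∈ Finset.univ.erase i,
      ((n : ℝ)⁻¹ * ∑ r : Fin n, α ℓ r) • dv ℓ⟫ = 0 := by
    rw [inner_sum]
    refine Finset.sum_eq_zero fun ℓ hℓ => ?_
    rw [real_inner_smul_right, horth i ℓ (Finset.ne_of_mem_erase hℓ).symm, mul_zero]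
  have huz : ⟪dv i, ∑ t : Fin k, α t (c t) • dv t⟫ = α i (c i) * ‖dv i‖ ^ 2 := by
    rw [inner_sum, Finset.sum_eq_single i, real_inner_smul_right, real_inner_self_eq_norm_sq]
    · intro t _ ht
      rw [real_inner_smul_right, horth i t ht.symm, mul_zero]
    · simp
  rw [prototype_score_eq huv huz, prototype_score_eq huv huz]
  have hne : α i j - α i (c i) ≠ 0 := sub_ne_zero.mpr ((hα i).ne hj)
  have hnorm : 0 < ‖dv i‖ := norm_pos_iff.mpr (hd0 i)
  have hpos : 0 < (α i j - α i (c i)) ^ 2 * ‖dv i‖ ^ 2 := by positivity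
  linarith
end
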